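/- For every K ∈ ℕ there exists N(K) ∈ ℕ such that for every ring R and every finite K-approximate subring X ⊆ R, setting Y := 4X + X·4X, at least one of the following holds: (i) there exists an additively symmetric subset D ⊆ Y which is N(K)-thick in Y and all of whose elements are zero divisors of R; (ii) Y is a subring of R, and moreover Y is contained in a union of K^{11} additive translates of X. -/

import Mathlib

open Pointwise

universe u

/-- A subset of a ring is additively symmetric if it contains `0` and equals its negation. -/
def AddSymm {R : Type u} [NonUnitalRing R] (X : Set R) : Prop :=
  (0 : R) ∈ X ∧ X = -X

/-- `X` is a `K`-approximate subring: it is additively symmetric and `X·X ∪ (X+X)` is covered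
by at most `K` additive translates of `X`. -/
def IsApproxSubringWith {R : Type u} [NonUnitalRing R] (K : ℕ) (X : Set R) : Prop :=
  AddSymm X ∧ ∃ F : Finset R, F.card ≤ K ∧ (X * X) ∪ (X + X) ⊆ (F : Set R) + X

/-- `A` and `B` are `N`-commensurable: each is covered by at most `N` additive translates
of the other. -/
def NCommensurable {R : Type u} [NonUnitalRing R] (N : ℕ) (A B : Set R) : Prop :=
  (∃ F : Finset R, F.card ≤ N ∧ A ⊆ (F : Set R) + B) ∧
  (∃ G : Finset R, G.card ≤ N ∧ B ⊆ (G : Set R) + A)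

/-- `mulIter S n` is the set of (left-nested) products of `n+1` elements of `S`. -/
def mulIter {R : Type u} [NonUnitalRing R] (S : Set R) : ℕ → Set R
  | 0 => S
  | n + 1 => mulIter S n * S

/-- `I` is a two-sided ideal of the subring `S` (both given as sets). -/
def IsTwoSidedIdealIn {R : Type u} [NonUnitalRing R] (I S : Set R) : Prop :=
  I ⊆ S ∧ (0 : R) ∈ I ∧ (∀ x ∈ I, ∀ y ∈ I, x + y ∈ I) ∧ (∀ x ∈ I, -x ∈ I) ∧
    ∀ r ∈ S, ∀ x ∈ I, r * x ∈ I ∧ x * r ∈ I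

/-- `S` is a subring of the ambient ring (as a set). -/
def IsSubringSet {R : Type u} [NonUnitalRing R] (S : Set R) : Prop :=
  (0 : R) ∈ S ∧ (∀ x ∈ S, ∀ y ∈ S, x + y ∈ S) ∧ (∀ x ∈ S, -x ∈ S) ∧
    ∀ x ∈ S, ∀ y ∈ S, x * y ∈ S

/-- `D` is `N`-thick in `Y` (with respect to the additive group structure): among any `N`
elements of `Y` some difference of two of them lies in `D`. -/
def NThickIn {R : Type u} [NonUnitalRing R] (N : ℕ) (D Y : Set R) : Prop :=
  ∀ r : Fin N → R, (∀ i, r i ∈ Y) → ∃ i j : Fin N, i < j ∧ r j - r i ∈ D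

/-- `A` is covered by `n` translates of `X`. -/
def Cov {R : Type u} [NonUnitalRing R] (X : Set R) (n : ℕ) (A : Set R) : Prop :=
  ∃ F : Finset R, F.card ≤ n ∧ A ⊆ (F : Set R) + X

/-- Left and right multiples of `X` by `g` are covered by `n` translates of `X`. -/
def Tame {R : Type u} [NonUnitalRing R] (X : Set R) (n : ℕ) (g : R) : Prop :=
  Cov X n ({g} * X) ∧ Cov X n (X * {g})

/-- `A` is covered by `n` translates and all its elements are tame. -/
def Good {R : Type u} [NonUnitalRing R] (X : Set R) (n : ℕ) (A : Set R) : Prop :=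
  Cov X n A ∧ ∀ a ∈ A, Tame X n a

section aux
variable {R : Type u} [NonUnitalRing R] {X : Set R}

theorem Cov.mono {n m : ℕ} {A B : Set R} (h : Cov X n A) (hnm : n ≤ m) (hB : B ⊆ A) :
    Cov X m B := by
  obtain ⟨F, h1, h2⟩ := h
  exact ⟨F, h1.trans hnm, hB.trans h2⟩

theorem Cov.finset_add {m : ℕ} {B : Set R} (F : Finset R) (h : Cov X m B) :
    Cov X (F.card * m) ((F : Set R) + B) := by
  classical
  obtain ⟨G, h1, h2⟩ := h
  refine ⟨F + G, Finset.card_add_le.trans (Nat.mul_le_mul_left _ h1), ?_⟩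
  rw [Finset.coe_add, add_assoc]
  exact Set.add_subset_add_left h2

theorem Cov.add {K n m : ℕ} {A B : Set R} (hA : Cov X n A) (hX : Cov X K (X + X))
    (hB : Cov X m B) : Cov X (n * m * K) (A + B) := by
  classical
  obtain ⟨F, h1, h2⟩ := hA
  obtain ⟨G, h3, h4⟩ := hB
  refine (Cov.finset_add (F + G) hX).mono ?_ ?_
  · exact Nat.mul_le_mul_right _ (Finset.card_add_le.trans (Nat.mul_le_mul h1 h3))
  · rw [Finset.coe_add, add_add_add_comm (F : Set R)  (G : Set R) X X]
    exact Set.add_subset_add h2 h4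

theorem Cov.refine {n : ℕ} {A : Set R} (hs : X = -X) (hA : Cov X n A) :
    ∃ F : Finset R, F.card ≤ n ∧ A ⊆ (F : Set R) + X ∧ (F : Set R) ⊆ A + X := by
  classical
  obtain ⟨F, h1, h2⟩ := hA
  refine ⟨F.filter (fun f => f ∈ A + X), (Finset.card_filter_le _ _).trans h1, ?_, ?_⟩
  · intro a ha
    obtain ⟨f, hf, x, hx, rfl⟩ := h2 ha
    refine ⟨f, ?_, x, hx, rfl⟩
    simp only [Finset.coe_filter, Set.mem_ofPred_eq]
    refine ⟨hf, f + x, ha, -x, ?_, by simp⟩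
    rw [hs]; simpa using hx
  · intro f hf
    simp only [Finset.coe_filter, Set.mem_ofPred_eq] at hf
    exact hf.2

theorem Cov.biUnion {ι : Type*} {m : ℕ} (s : Finset ι) (B : ι → Set R)
    (h : ∀ i ∈ s, Cov X m (B i)) : Cov X (s.card * m) (⋃ i ∈ s, B i) := by
  classical
  have h' : ∀ i : ι, ∃ F : Finset R, i ∈ s → F.card ≤ m ∧ B i ⊆ (F : Set R) + X := by
    intro i
    by_cases hi : i ∈ s
    · obtain ⟨F, hF⟩ := h i hi
      exact ⟨F, fun _ => hF⟩
    · exact ⟨∅, fun h => absurd h hi⟩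
  choose F hF using h'
  refine ⟨s.biUnion F, Finset.card_biUnion_le_card_mul _ _ _ (fun i hi => (hF i hi).1), ?_⟩
  intro a ha
  simp only [Set.mem_iUnion] at ha
  obtain ⟨i, hi, hai⟩ := ha
  obtain ⟨f, hf, x, hx, rfl⟩ := (hF i hi).2 hai
  refine ⟨f, ?_, x, hx, rfl⟩
  simp only [Finset.coe_biUnion, Set.mem_iUnion]
  exact ⟨i, hi, hf⟩

theorem Tame.mono {n m : ℕ} {a : R} (h : Tame X n a) (hnm : n ≤ m) : Tame X m a :=
  ⟨h.1.mono hnm subset_rfl, h.2.mono hnm subset_rfl⟩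

theorem Tame.add {K n m : ℕ} {a b : R} (hX : Cov X K (X + X)) (ha : Tame X n a)
    (hb : Tame X m b) : Tame X (n * m * K) (a + b) := by
  constructor
  · refine (Cov.add ha.1 hX hb.1).mono le_rfl ?_
    rw [← Set.singleton_add_singleton]
    exact Set.add_mul_subset _ _ _
  · refine (Cov.add ha.2 hX hb.2).mono le_rfl ?_
    rw [← Set.singleton_add_singleton]
    exact Set.mul_add_subset _ _ _

theorem Tame.mul {n m : ℕ} {a b : R} (ha : Tame X n a)
    (hb : Tame X m b) : Tame X (n * m) (a * b) := by
  classical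
  constructor
  · obtain ⟨F, h1, h2⟩ := hb.1
    refine (Cov.finset_add ({a} * F) ha.1).mono (m := n * m) ?_ ?_
    · rw [mul_comm]
      exact Nat.mul_le_mul_left _ (Finset.card_mul_le.trans (by simpa using h1))
    · rw [← Set.singleton_mul_singleton, mul_assoc, Finset.coe_mul, Finset.coe_singleton]
      exact (Set.mul_subset_mul_left h2).trans (Set.mul_add_subset _ _ _)
  · obtain ⟨F, h1, h2⟩ := ha.2
    refine (Cov.finset_add (F * {b}) hb.2).mono (m := n * m) ?_ ?_
    · exact Nat.mul_le_mul_right _ (Finset.card_mul_le.trans (by simpa using h1))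
    · rw [← Set.singleton_mul_singleton, ← mul_assoc, Finset.coe_mul, Finset.coe_singleton]
      exact (Set.mul_subset_mul_right h2).trans (Set.add_mul_subset _ _ _)

theorem Good.self {K : ℕ} (hK : 1 ≤ K) (hm : Cov X K (X * X)) : Good X K X := by
  refine ⟨⟨{0}, by simpa using hK, by simp⟩, fun a ha => ⟨?_, ?_⟩⟩
  · exact hm.mono le_rfl (Set.mul_subset_mul_right (by simpa using ha))
  · exact hm.mono le_rfl (Set.mul_subset_mul_left (by simpa using ha))

theorem Good.mono {n m : ℕ} {A : Set R} (h : Good X n A) (hnm : n ≤ m) : Good X m A :=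
  ⟨h.1.mono hnm subset_rfl, fun a ha => (h.2 a ha).mono hnm⟩

theorem Good.add {K n m : ℕ} {A B : Set R} (hX : Cov X K (X + X)) (hA : Good X n A)
    (hB : Good X m B) : Good X (n * m * K) (A + B) := by
  refine ⟨hA.1.add hX hB.1, ?_⟩
  rintro _ ⟨a, ha, b, hb, rfl⟩
  exact (hA.2 a ha).add hX (hB.2 b hb)

theorem Good.mul {K n m : ℕ} {A B : Set R} (hK : 1 ≤ K) (hs : X = -X) (hX : Cov X K (X + X))
    (hm : Cov X K (X * X)) (hA : Good X n A) (hB : Good X m B) :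
    Good X ((n * m) * (1 * ((n * K * K) * (m * K * K) * K * K * K)) + n * m) (A * B) := by
  classical
  constructor
  · obtain ⟨F, f1, f2, f3⟩ := hA.1.refine hs
    obtain ⟨G, g1, g2, g3⟩ := hB.1.refine hs
    have hF : ∀ f ∈ F, Tame X (n * K * K) f := fun f hf =>
      (Good.add hX hA (Good.self hK hm)).2 f (f3 hf)
    have hG : ∀ g ∈ G, Tame X (m * K * K) g := fun g hg =>
      (Good.add hX hB (Good.self hK hm)).2 g (g3 hg)
    have key := Cov.biUnion (X := X) (m := 1 * ((n * K * K) * (m * K * K) * K * K * K)) (F ×ˢ G)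
      (fun p => ((({p.1 * p.2} : Finset R) : Set R) + ({p.1} * X + X * {p.2} + X * X))) (by
        rintro ⟨f, g⟩ hfg
        rw [Finset.mem_product] at hfg
        have := Cov.finset_add {f * g}
          (((hF f hfg.1).1.add hX (hG g hfg.2).2).add hX hm)
        simpa using this)
    refine key.mono ?_ ?_
    · rw [Finset.card_product]
      exact (Nat.mul_le_mul_right _ (Nat.mul_le_mul f1 g1)).trans (Nat.le_add_right _ _)
    · rintro _ ⟨a, ha, b, hb, rfl⟩
      obtain ⟨f, hf, x, hx, rfl⟩ := f2 ha
      obtain ⟨g, hg, y, hy, rfl⟩ := g2 hb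
      simp only [Set.mem_iUnion]
      refine ⟨(f, g), Finset.mem_product.2 ⟨hf, hg⟩, f * g, by simp,
        f * y + x * g + x * y, ⟨f * y + x * g, ⟨f * y, ⟨f, rfl, y, hy, rfl⟩, x * g,
          ⟨x, hx, g, rfl, rfl⟩, rfl⟩, x * y, ⟨x, hx, y, hy, rfl⟩, rfl⟩, ?_⟩
      simp only [add_mul, mul_add]
      abel
  · rintro _ ⟨a, ha, b, hb, rfl⟩
    exact ((hA.2 a ha).mul (hB.2 b hb)).mono (Nat.le_add_left _ _)

end aux

/-- A uniform bound for the ambient set used in the proof. -/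
theorem exists_good_bound (K : ℕ) : ∃ c : ℕ, ∀ (R : Type u) [NonUnitalRing R] (X : Set R),
    1 ≤ K → X = -X → Cov X K (X + X) → Cov X K (X * X) →
    ∀ Y : Set R, Y = (X + X + X + X) + X * (X + X + X + X) →
      Good X c (Y * Y + (Y + Y) + X) ∧ Cov X c (Y * Y + (Y + Y)) := by
  let addB : ℕ → ℕ → ℕ := fun n m => n * m * K
  let mulB : ℕ → ℕ → ℕ := fun n m =>
    (n * m) * (1 * ((n * K * K) * (m * K * K) * K * K * K)) + n * m
  let k4 := addB (addB (addB K K) K) K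
  let kY := addB k4 (mulB K k4)
  let kT := addB (mulB kY kY) (addB kY kY)
  refine ⟨addB kT K + kT, fun R _ X hK hs ha hm Y hY => ?_⟩
  have h1 := Good.self hK hm
  have h4 := ((h1.add ha h1).add ha h1).add ha h1
  have hYg := h4.add ha (h1.mul hK hs ha hm h4)
  rw [← hY] at hYg
  have hT := (hYg.mul hK hs ha hm hYg).add ha (hYg.add ha hYg)
  have hTX := hT.add ha h1
  exact ⟨hTX.mono (Nat.le_add_right _ _), hT.1.mono (Nat.le_add_left _ _) subset_rfl⟩

theorem cov_Y {R : Type u} [NonUnitalRing R] {X : Set R} {K : ℕ}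
    (ha : Cov X K (X + X)) (hm : Cov X K (X * X)) :
    Cov X (K ^ 11) ((X + X + X + X) + X * (X + X + X + X)) := by
  have h1 : Cov X 1 X := ⟨{0}, by simp, by simp⟩
  have h4 := ((h1.add ha h1).add ha h1).add ha h1
  have m4 := ((hm.add ha hm).add ha hm).add ha hm
  have m4' : Cov X _ (X * (X + X + X + X)) := m4.mono le_rfl (by
    rintro _ ⟨x, hx, _, ⟨_, ⟨_, ⟨a, h1, b, h2, rfl⟩, c, h3, rfl⟩, d, h4, rfl⟩, rfl⟩
    simp only [mul_add]
    exact Set.add_mem_add (Set.add_mem_add (Set.add_mem_add (Set.mul_mem_mul hx h1)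
      (Set.mul_mem_mul hx h2)) (Set.mul_mem_mul hx h3)) (Set.mul_mem_mul hx h4))
  exact (h4.add ha m4').mono (le_of_eq (by ring)) subset_rfl

/-- Sum-product dichotomy via thick sets of zero divisors: for every `K` there is `N(K)` such
that for every finite `K`-approximate subring `X`, with `Y := 4X + X·4X`, either `Y` has an
additively symmetric `N(K)`-thick subset consisting of zero divisors, or `Y` is a subring
(covered by `K^11` additive translates of `X`). -/
theorem stmt8 (K : ℕ) :
    ∃ N : ℕ, ∀ (R : Type u) [NonUnitalRing R] (X : Set R),
      X.Finite → IsApproxSubringWith K X →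
      ∀ Y : Set R, Y = (X + X + X + X) + X * (X + X + X + X) →
      (∃ D : Set R, D ⊆ Y ∧ AddSymm D ∧ NThickIn N D Y ∧
          ∀ d ∈ D, ∃ z : R, z ≠ 0 ∧ (d * z = 0 ∨ z * d = 0)) ∨
      (IsSubringSet Y ∧ ∃ F : Finset R, F.card ≤ K ^ 11 ∧ Y ⊆ (F : Set R) + X) := by
  classical
  obtain ⟨c, hc⟩ := exists_good_bound.{u} K
  refine ⟨K ^ 11 * (c + 1) ^ c + 1, fun R _ X hfin hX Y hY => ?_⟩
  obtain ⟨⟨h0, hs⟩, E, hE, hEX⟩ := hX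
  have ha : Cov X K (X + X) := ⟨E, hE, Set.subset_union_right.trans hEX⟩
  have hm : Cov X K (X * X) := ⟨E, hE, Set.subset_union_left.trans hEX⟩
  have hK : 1 ≤ K := by
    obtain ⟨f, hf, _⟩ := hEX (Or.inl (Set.mul_mem_mul h0 h0))
    exact (Finset.card_pos.2 ⟨f, hf⟩).trans_le hE
  have hneg : ∀ x ∈ X, -x ∈ X := fun x hx => by rw [hs]; simpa using hx
  have hcY : Cov X (K ^ 11) Y := hY ▸ cov_Y ha hm
  obtain ⟨hTX, hT⟩ := hc R X hK hs ha hm Y hY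
  have h4 : ∀ x ∈ X, ∀ y ∈ X, x + y ∈ X + X + X + X := fun x hx y hy =>
    ⟨x + y + 0, ⟨x + y, ⟨x, hx, y, hy, rfl⟩, 0, h0, rfl⟩, 0, h0, by simp⟩
  have hYin : ∀ a ∈ X, ∀ b ∈ X, ∀ x ∈ X, ∀ d ∈ X, ∀ e ∈ X,
      (a + b) + x * (d + e) ∈ Y := by
    intro a ha b hb x hx d hd e he
    rw [hY]
    exact ⟨a + b, h4 a ha b hb, x * (d + e), ⟨x, hx, d + e, h4 d hd e he, rfl⟩, rfl⟩
  have h2Y : ∀ a ∈ X, ∀ b ∈ X, a + b ∈ Y := by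
    intro a ha b hb
    simpa using hYin a ha b hb 0 h0 0 h0 0 h0
  have hY0 : (0 : R) ∈ Y := by simpa using h2Y 0 h0 0 h0
  have hneg4 : ∀ z ∈ X + X + X + X, -z ∈ X + X + X + X := by
    rintro _ ⟨_, ⟨_, ⟨p, h1, q, h2, rfl⟩, r, h3, rfl⟩, t, h4, rfl⟩
    exact ⟨-p + -q + -r, ⟨-p + -q, ⟨-p, hneg p h1, -q, hneg q h2, rfl⟩, -r, hneg r h3, rfl⟩,
      -t, hneg t h4, by simp only []; abel⟩
  have hYneg : ∀ y ∈ Y, -y ∈ Y := by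
    intro y hy
    rw [hY] at hy ⊢
    obtain ⟨p, hp, _, ⟨x, hx, q, hq, rfl⟩, rfl⟩ := hy
    exact ⟨-p, hneg4 p hp, x * (-q), ⟨x, hx, -q, hneg4 q hq, rfl⟩, by
      simp only [mul_neg]; abel⟩
  have hYfin : Y.Finite := by
    have h4f := ((hfin.add hfin).add hfin).add hfin
    rw [hY]; exact h4f.add (hfin.mul h4f)
  by_cases hD : Nontrivial R ∧ NThickIn (K ^ 11 * (c + 1) ^ c + 1)
      {d : R | d ∈ Y ∧ ∃ z : R, z ≠ 0 ∧ (d * z = 0 ∨ z * d = 0)} Y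
  · left
    refine ⟨{d : R | d ∈ Y ∧ ∃ z : R, z ≠ 0 ∧ (d * z = 0 ∨ z * d = 0)}, fun d hd => hd.1,
      ⟨⟨hY0, ?_⟩, ?_⟩, hD.2, fun d hd => hd.2⟩
    · obtain ⟨z, hz⟩ := @exists_ne R hD.1 0
      exact ⟨z, hz, by simp⟩
    · ext d
      simp only [Set.mem_neg, Set.mem_ofPred_eq, neg_mul, mul_neg, neg_eq_zero]
      constructor
      · exact fun h => ⟨hYneg _ h.1, h.2⟩
      · exact fun h => ⟨by simpa using hYneg _ h.1, h.2⟩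
  right
  have hYT : Y ⊆ Y * Y + (Y + Y) := fun y hy =>
    ⟨0, ⟨0, hY0, 0, hY0, by simp⟩, y, ⟨y, hy, 0, hY0, by simp⟩, by simp⟩
  have main : Y * Y + (Y + Y) ⊆ Y := by
    by_cases hn : Nontrivial R
    swap
    · have := not_nontrivial_iff_subsingleton.1 hn
      intro t _
      rwa [Subsingleton.elim t 0]
    have hD' := not_and.1 hD hn
    unfold NThickIn at hD'
    push Not at hD'
    obtain ⟨r, hr, hrD⟩ := hD'
    obtain ⟨P, hP, hPY⟩ := hcY
    obtain ⟨G, hG, hTG, hGT⟩ := hT.refine hs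
    have hgH : ∀ g : G, ∃ H : Finset R, H.card ≤ c ∧ {g.1} * X ⊆ (H : Set R) + X :=
      fun g => (hTX.2 g.1 (hGT g.2)).1
    choose H hH hHX using hgH
    have hr1 : ∀ i, ∃ p : P, ∃ x ∈ X, p.1 + x = r i := by
      intro i
      obtain ⟨p, hp, x, hx, h⟩ := hPY (hr i)
      exact ⟨⟨p, hp⟩, x, hx, h⟩
    choose p s hsX hps using hr1
    have hcol : ∀ i, ∀ g : G, ∃ h : H g, ∃ x ∈ X, h.1 + x = g.1 * s i := by
      intro i g
      obtain ⟨h, hh, x, hx, e⟩ := hHX g (Set.mul_mem_mul rfl (hsX i))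
      exact ⟨⟨h, hh⟩, x, hx, e⟩
    choose q w hwX hqw using hcol
    have hcard : Fintype.card (P × ((g : G) → H g)) <
        Fintype.card (Fin (K ^ 11 * (c + 1) ^ c + 1)) := by
      rw [Fintype.card_prod, Fintype.card_pi, Fintype.card_fin, Fintype.card_coe]
      refine Nat.lt_succ_of_le (Nat.mul_le_mul hP ?_)
      calc ∏ g : G, Fintype.card (H g) ≤ ∏ g : G, (c + 1) := by
            refine Finset.prod_le_prod' fun g _ => ?_
            rw [Fintype.card_coe]
            exact (hH g).trans (Nat.le_succ c)
        _ = (c + 1) ^ G.card := by simp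
        _ ≤ (c + 1) ^ c := Nat.pow_le_pow_right (Nat.succ_pos c) hG
    obtain ⟨i, j, hij, hcolij⟩ := Fintype.exists_ne_map_eq_of_card_lt
      (fun i => ((p i, q i) : P × ((g : G) → H g))) hcard
    wlog hlt : i < j generalizing i j
    · exact this j i hij.symm hcolij.symm (lt_of_le_of_ne (not_lt.1 hlt) hij.symm)
    simp only [Prod.mk.injEq] at hcolij
    obtain ⟨hpij, hqij⟩ := hcolij
    have hb : r j - r i = s j + -s i := by
      rw [← hps, ← hps, hpij]; abel
    have hbD := hrD i j hlt
    rw [hb] at hbD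
    have hbY : s j + -s i ∈ Y := h2Y _ (hsX j) _ (hneg _ (hsX i))
    have hreg : ∀ z : R, z * (s j + -s i) = 0 → z = 0 := by
      intro z hz
      by_contra hz0
      exact hbD ⟨hbY, z, hz0, Or.inr hz⟩
    have hmap : Set.MapsTo (fun t => t * (s j + -s i)) (Y * Y + (Y + Y)) Y := by
      intro t ht
      obtain ⟨g, hg, x, hx, rfl⟩ := hTG ht
      have e : (g + x) * (s j + -s i) =
          (w j ⟨g, hg⟩ + -w i ⟨g, hg⟩) + x * (s j + -s i) := by
        have e1 := hqw j ⟨g, hg⟩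
        have e2 := hqw i ⟨g, hg⟩
        rw [hqij] at e2
        simp only [add_mul, mul_add, mul_neg] at *
        rw [← e1, ← e2]
        abel
      simp only [e]
      exact hYin _ (hwX _ _) _ (hneg _ (hwX _ _)) _ hx _ (hsX j) _ (hneg _ (hsX i))
    have hinj : Set.InjOn (fun t => t * (s j + -s i)) (Y * Y + (Y + Y)) := by
      intro t _ t' _ h
      simp only at h
      have := hreg (t - t') (by rw [sub_mul, h, sub_self])
      exact sub_eq_zero.1 this
    have hle := Set.ncard_le_ncard_of_injOn _ hmap hinj hYfin
    have hTfin : (Y * Y + (Y + Y)).Finite := (hYfin.mul hYfin).add (hYfin.add hYfin)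
    exact (Set.eq_of_subset_of_ncard_le hYT hle hTfin).ge
  refine ⟨⟨hY0, fun x hx y hy => main ?_, hYneg, fun x hx y hy => main ?_⟩, hcY⟩
  · exact ⟨0, ⟨0, hY0, 0, hY0, by simp⟩, x + y, ⟨x, hx, y, hy, rfl⟩, by simp⟩
  · exact ⟨x * y, ⟨x, hx, y, hy, rfl⟩, 0, ⟨0, hY0, 0, hY0, by simp⟩, by simp⟩
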